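/- arXiv:2306.08493 — 2 statements merged into one kernel-verified Lean document; each statement's English description precedes it below -/
import Mathlib

section
/- Let R be monic in F_q[T] and A, B ∈ F_q[T]. If gcd(AB, R) = 1 then the sum over primitive Dirichlet characters χ modulo R of χ(A)·conj(χ)(B) equals Σ_{EF=R, F | (A−B)} μ(E)·φ(F); if gcd(AB, R) ≠ 1 the sum is 0. -/
open Polynomial UniqueFactorizationMonoid
open scoped Classical

noncomputable section

variable {Fq : Type} [Field Fq] [Fintype Fq]

/-- The norm `|f| = q ^ deg f` of a polynomial, as a real number. -/
def pnorm (f : Fq[X]) : ℝ := (Fintype.card Fq : ℝ) ^ f.natDegree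

/-- The norm `|f| = q ^ deg f` of a polynomial, as a complex number. -/
def pnormC (f : Fq[X]) : ℂ := (Fintype.card Fq : ℂ) ^ f.natDegree

/-- The Möbius function for polynomials over a finite field. -/
def polyMu (f : Fq[X]) : ℤ :=
  if Squarefree f then (-1) ^ (normalizedFactors f).toFinset.card else 0

/-- The number of distinct monic irreducible factors of `f`. -/
def omegaP (f : Fq[X]) : ℕ := (normalizedFactors f).toFinset.card

/-- The Euler totient of `f` : the number of units of `Fq[X]/(f)`. -/
def polyPhi (f : Fq[X]) : ℕ := Nat.card (Fq[X] ⧸ Ideal.span {f})ˣ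
/-- A Dirichlet character modulo `R` (a multiplicative character of `Fq[X]/(R)` valued in `ℂ`)
is primitive if it is not induced by a character of any monic divisor modulus of smaller
degree. -/
def IsPrimitiveChar (R : Fq[X]) (χ : MulChar (Fq[X] ⧸ Ideal.span {R}) ℂ) : Prop :=
  ∀ S : Fq[X], S.Monic → S ∣ R → S.natDegree < R.natDegree →
    ¬ ∃ χ₁ : MulChar (Fq[X] ⧸ Ideal.span {S}) ℂ,
        ∀ A : Fq[X], IsCoprime A R →
          χ (Ideal.Quotient.mk (Ideal.span {R}) A) = χ₁ (Ideal.Quotient.mk (Ideal.span {S}) A)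

/-- `φ*(R)`, the number of primitive Dirichlet characters modulo `R`. -/
def phiStar (R : Fq[X]) : ℕ :=
  Nat.card {χ : MulChar (Fq[X] ⧸ Ideal.span {R}) ℂ // IsPrimitiveChar R χ}

theorem isUnit_quotient_mk_iff_isCoprime {K : Type} [Field K] (R a : K[X]) :
    IsUnit (Ideal.Quotient.mk (Ideal.span {R}) a) ↔ IsCoprime a R := by
  rw [isUnit_iff_exists_inv]
  constructor
  · rintro ⟨b, hb⟩
    obtain ⟨b, rfl⟩ := Ideal.Quotient.mk_surjective b
    rw [← map_mul, ← map_one (Ideal.Quotient.mk _), Ideal.Quotient.mk_eq_mk_iff_sub_mem,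
      Ideal.mem_span_singleton] at hb
    obtain ⟨c, hc⟩ := hb
    exact ⟨b, -c, by linear_combination hc⟩
  · rintro ⟨b, c, h⟩
    refine ⟨Ideal.Quotient.mk _ b, ?_⟩
    rw [← map_mul, ← map_one (Ideal.Quotient.mk _), Ideal.Quotient.mk_eq_mk_iff_sub_mem,
      Ideal.mem_span_singleton]
    exact ⟨-c, by linear_combination h⟩

theorem finite_quotient_span_singleton {R : Fq[X]} (hR : R.Monic) :
    Finite (Fq[X] ⧸ Ideal.span {R}) :=
  have := hR.finite_quotient
  Module.finite_of_finite Fq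

/-- Reduction of unit residue classes modulo `R` to those modulo a divisor `S`. -/
def reduceUnits {R S : Fq[X]} (h : S ∣ R) :
    (Fq[X] ⧸ Ideal.span {R})ˣ →* (Fq[X] ⧸ Ideal.span {S})ˣ :=
  Units.map (Ideal.Quotient.factor (Ideal.span_singleton_le_span_singleton.mpr h)).toMonoidHom

theorem exists_isCoprime_dvd_sub {K : Type} [Field K] {R S : K[X]} (hR : R ≠ 0) {a : K[X]}
    (ha : IsCoprime a S) : ∃ b, IsCoprime b R ∧ S ∣ b - a := by
  let k := ∏ P ∈ (primeFactors R).filter (fun P ↦ ¬ P ∣ a), P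
  refine ⟨a + S * k, isCoprime_of_prime_dvd (fun h ↦ hR h.2) fun z hz h1 h2 ↦ ?_, k, by ring⟩
  obtain ⟨P, hP, hzP⟩ := exists_mem_normalizedFactors_of_dvd hR hz.irreducible h2
  have hPp := prime_of_normalized_factor P hP
  have h3 : P ∣ a + S * k := hzP.symm.dvd.trans h1
  by_cases hPa : P ∣ a
  · have h4 : P ∣ S * k := (dvd_add_right hPa).mp h3
    rcases hPp.dvd_or_dvd h4 with h | h
    · exact hPp.not_isUnit (ha.isUnit_of_dvd' hPa h)
    · obtain ⟨Q, hQ, hPQ⟩ := (hPp.dvd_finsetProd_iff _).mp h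
      rw [Finset.mem_filter, mem_primeFactors] at hQ
      have := (hPp.associated_of_dvd (prime_of_normalized_factor Q hQ.1) hPQ)
      exact hQ.2 (this.symm.dvd.trans hPa)
  · apply hPa
    refine (dvd_add_left (Dvd.dvd.mul_left (Finset.dvd_prod_of_mem _ ?_) S)).mp h3
    simpa [hPa] using mem_primeFactors.mpr hP

theorem reduceUnits_surjective {K : Type} [Field K] {R S : K[X]} (hR : R ≠ 0) (h : S ∣ R) :
    Function.Surjective (reduceUnits h) := by
  intro u
  obtain ⟨a, ha⟩ := Ideal.Quotient.mk_surjective u.val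
  obtain ⟨b, hb, hba⟩ := exists_isCoprime_dvd_sub hR
    ((isUnit_quotient_mk_iff_isCoprime S a).mp (ha ▸ u.isUnit))
  refine ⟨((isUnit_quotient_mk_iff_isCoprime R b).mpr hb).unit, Units.ext ?_⟩
  rw [← ha]
  exact (Ideal.Quotient.mk_eq_mk_iff_sub_mem _ _).mpr (Ideal.mem_span_singleton.mpr hba)

theorem mem_ker_reduceUnits_iff {K : Type} [Field K] {R S : K[X]} (h : S ∣ R)
    (u : (K[X] ⧸ Ideal.span {R})ˣ) {a : K[X]} (ha : Ideal.Quotient.mk _ a = u.val) :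
    u ∈ (reduceUnits h).ker ↔ S ∣ a - 1 := by
  rw [MonoidHom.mem_ker, Units.ext_iff, ← Ideal.mem_span_singleton,
    ← Ideal.Quotient.mk_eq_mk_iff_sub_mem]
  change Ideal.Quotient.factor _ u.val = 1 ↔ _
  rw [← ha, Ideal.Quotient.factor_mk, map_one]

/-- A character modulo `R` is trivial modulo `S` if it is `1` on the units modulo `R`
congruent to `1` modulo `S`. -/
def TrivialMod (R S : Fq[X]) (χ : MulChar (Fq[X] ⧸ Ideal.span {R}) ℂ) : Prop :=
  ∀ a : Fq[X], IsCoprime a R → S ∣ a - 1 → χ (Ideal.Quotient.mk (Ideal.span {R}) a) = 1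

theorem trivialMod_iff_forall_mem_ker {K : Type} [Field K] {R S : K[X]} (h : S ∣ R)
    (χ : MulChar (K[X] ⧸ Ideal.span {R}) ℂ) :
    TrivialMod R S χ ↔ ∀ u ∈ (reduceUnits h).ker, χ u.val = 1 := by
  constructor
  · intro hχ u hu
    obtain ⟨a, ha⟩ := Ideal.Quotient.mk_surjective u.val
    rw [← ha]
    exact hχ a ((isUnit_quotient_mk_iff_isCoprime R a).mp (ha ▸ u.isUnit))
      ((mem_ker_reduceUnits_iff h u ha).mp hu)
  · intro hχ a ha hS
    have hu := (isUnit_quotient_mk_iff_isCoprime R a).mpr ha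
    exact hχ hu.unit ((mem_ker_reduceUnits_iff h hu.unit hu.unit_spec.symm).mpr hS)

theorem exists_mulChar_eq_iff_trivialMod {K : Type} [Field K] {R S : K[X]} (hR : R ≠ 0)
    (h : S ∣ R)
    (χ : MulChar (K[X] ⧸ Ideal.span {R}) ℂ) :
    (∃ χ₁ : MulChar (K[X] ⧸ Ideal.span {S}) ℂ, ∀ A : K[X], IsCoprime A R →
      χ (Ideal.Quotient.mk (Ideal.span {R}) A) = χ₁ (Ideal.Quotient.mk (Ideal.span {S}) A)) ↔
      TrivialMod R S χ := by
  constructor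
  · rintro ⟨χ₁, h₁⟩ a ha hS
    rw [h₁ a ha, (Ideal.Quotient.mk_eq_mk_iff_sub_mem a 1).mpr (Ideal.mem_span_singleton.mpr hS),
      map_one, map_one]
  · intro hχ
    rw [trivialMod_iff_forall_mem_ker h] at hχ
    have hker : (reduceUnits h).ker ≤ χ.toUnitHom.ker := fun u hu ↦ by
      rw [MonoidHom.mem_ker, Units.ext_iff, MulChar.coe_toUnitHom]
      exact hχ u hu
    refine ⟨MulChar.ofUnitHom (MonoidHom.liftOfSurjective (reduceUnits h)
      (reduceUnits_surjective hR h) ⟨χ.toUnitHom, hker⟩), fun A hA ↦ ?_⟩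
    have hu := (isUnit_quotient_mk_iff_isCoprime R A).mpr hA
    have h2 : Ideal.Quotient.mk (Ideal.span {S}) A = (reduceUnits h hu.unit).val := rfl
    rw [h2, MulChar.ofUnitHom_coe, MonoidHom.liftOfRightInverse_comp_apply,
      MulChar.coe_toUnitHom, hu.unit_spec]

/-- Orthogonality of the characters of a finite monoid that are trivial on a subgroup. -/
theorem sum_mulChar_trivial_on {M : Type} [CommMonoid M] [Finite M] [Fintype (MulChar M ℂ)]
    (H : Subgroup Mˣ) (u : Mˣ) :
    ∑ χ : MulChar M ℂ with ∀ m ∈ H, χ m.val = 1, χ u.val =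
      if u ∈ H then (H.index : ℂ) else 0 := by
  let Y := (MulChar.subgroupOrderIsoSubgroupMulChar M ℂ H).ofDual
  have hY (χ) : χ ∈ Y ↔ ∀ m ∈ H, χ m.val = 1 :=
    MulChar.mem_subgroupOrderIsoSubgroupMulChar_iff
  split_ifs with hu
  · have h1 : ∀ χ ∈ Finset.univ.filter (fun χ : MulChar M ℂ ↦ ∀ m ∈ H, χ m.val = 1),
        χ u.val = 1 := fun χ hχ ↦ (Finset.mem_filter.mp hχ).2 u hu
    rw [Finset.sum_congr rfl h1, Finset.sum_const, nsmul_one, Subgroup.index,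
      ← MulChar.card_subgroupOrderIsoSubgroupMulChar (R := ℂ),
      ← Fintype.card_subtype, ← Nat.card_eq_fintype_card]
    exact congrArg _ (Nat.card_congr (Equiv.subtypeEquivRight fun χ ↦ (hY χ).symm))
  · obtain ⟨ψ, hψ, hne⟩ : ∃ ψ ∈ Y, ψ u.val ≠ 1 := by
      by_contra! hc
      have := MulChar.mem_subgroupOrderIsoSubgroupMulChar_symm_iff (X := Y) |>.mpr hc
      exact hu (by simpa [Y] using this)
    refine eq_zero_of_mul_eq_self_left hne ?_
    rw [Finset.mul_sum]
    refine Finset.sum_equiv (Equiv.mulLeft ψ) (fun χ ↦ ?_) fun χ _ ↦ rfl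
    simp only [Finset.mem_filter, Finset.mem_univ, true_and, ← hY, Equiv.coe_mulLeft]
    exact (Y.mul_mem_cancel_left hψ).symm

theorem sum_trivialMod {R S A B : Fq[X]} (hR : R.Monic) (h : S ∣ R)
    [Fintype (MulChar (Fq[X] ⧸ Ideal.span {R}) ℂ)]
    (hA : IsCoprime A R) (hB : IsCoprime B R) :
    ∑ χ : MulChar (Fq[X] ⧸ Ideal.span {R}) ℂ with TrivialMod R S χ,
        χ (Ideal.Quotient.mk (Ideal.span {R}) A) *
            (starRingEnd ℂ) (χ (Ideal.Quotient.mk (Ideal.span {R}) B)) =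
      if S ∣ A - B then (polyPhi S : ℂ) else 0 := by
  have := finite_quotient_span_singleton hR
  have hu := (isUnit_quotient_mk_iff_isCoprime R A).mpr hA
  have hv := (isUnit_quotient_mk_iff_isCoprime R B).mpr hB
  have hval (χ : MulChar (Fq[X] ⧸ Ideal.span {R}) ℂ) :
      χ (Ideal.Quotient.mk (Ideal.span {R}) A) *
        (starRingEnd ℂ) (χ (Ideal.Quotient.mk (Ideal.span {R}) B)) =
      χ (hu.unit * hv.unit⁻¹ : (Fq[X] ⧸ Ideal.span {R})ˣ).val := by
    rw [Units.val_mul, map_mul, hu.unit_spec, starRingEnd_apply, MulChar.star_apply',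
      MulChar.inv_apply, ← Ring.inverse_unit, hv.unit_spec]
  have hmem : hu.unit * hv.unit⁻¹ ∈ (reduceUnits h).ker ↔ S ∣ A - B := by
    rw [MonoidHom.mem_ker, map_mul, map_inv, mul_inv_eq_one, Units.ext_iff,
      ← Ideal.mem_span_singleton, ← Ideal.Quotient.mk_eq_mk_iff_sub_mem]
    rfl
  have hidx : (reduceUnits h).ker.index = polyPhi S := by
    rw [Subgroup.index_ker, MonoidHom.range_eq_top.mpr (reduceUnits_surjective hR.ne_zero h),
      Subgroup.card_top, polyPhi]
  simp only [hval, trivialMod_iff_forall_mem_ker h, sum_mulChar_trivial_on, hmem, hidx]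

theorem trivialMod_mono {K : Type} [Field K] {R S T : K[X]} (h : S ∣ T)
    {χ : MulChar (K[X] ⧸ Ideal.span {R}) ℂ}
    (hχ : TrivialMod R S χ) : TrivialMod R T χ :=
  fun a ha hT ↦ hχ a ha (h.trans hT)

theorem trivialMod_self {K : Type} [Field K] (R : K[X]) (χ : MulChar (K[X] ⧸ Ideal.span {R}) ℂ) :
    TrivialMod R R χ := fun a _ h ↦ by
  rw [(Ideal.Quotient.mk_eq_mk_iff_sub_mem a 1).mpr (Ideal.mem_span_singleton.mpr h),
    map_one, map_one]

theorem TrivialMod.of_isCoprime {K : Type} [Field K] {R P Q W : K[X]} (hR : R = P * Q * W)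
    (hPQ : IsCoprime P Q)
    {χ : MulChar (K[X] ⧸ Ideal.span {R}) ℂ}
    (hP : TrivialMod R (Q * W) χ) (hQ : TrivialMod R (P * W) χ) : TrivialMod R W χ := by
  rintro a ha ⟨k, hk⟩
  obtain ⟨u, v, huv⟩ := hPQ
  have haP : IsCoprime a P := ha.of_isCoprime_of_dvd_right ⟨Q * W, by rw [hR]; ring⟩
  let x := 1 + W * k * v * Q
  have hx1 : IsCoprime x (Q * W) := ⟨1, -(k * v), by simp only [x]; ring⟩
  have hxa : x = a + P * (-(W * k * u)) := by
    simp only [x]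
    linear_combination -hk + W * k * huv
  have hxP : IsCoprime x P := by
    rw [hxa]
    exact IsCoprime.add_mul_left_left haP _
  have hx : IsCoprime x R := by
    rw [hR, mul_assoc]
    exact hxP.mul_right hx1
  obtain ⟨b, c, hbc⟩ := hx
  have hb : IsCoprime b R := ⟨x, c, by linear_combination hbc⟩
  have h1 := hP x ⟨b, c, hbc⟩ ⟨k * v, by simp only [x]; ring⟩
  have h2 := hQ (a * b) (ha.mul_left hb) ⟨k * u * b - c * Q, by
    linear_combination -b * hxa + hbc - c * hR⟩
  have h3 := trivialMod_self R χ (x * b) (IsCoprime.mul_left ⟨b, c, hbc⟩ hb)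
    ⟨-c, by linear_combination hbc⟩
  rw [map_mul, map_mul] at h2 h3
  rw [h1, one_mul] at h3
  rwa [h3, mul_one] at h2

theorem isCoprime_of_mem_primeFactors {K : Type} [Field K] {R P Q : K[X]}
    (hP : P ∈ primeFactors R) (hQ : Q ∈ primeFactors R) (hne : P ≠ Q) : IsCoprime P Q := by
  rw [mem_primeFactors] at hP hQ
  have hp := prime_of_normalized_factor P hP
  have hq := prime_of_normalized_factor Q hQ
  refine (hp.irreducible.coprime_iff_not_dvd).mpr fun h ↦ hne ?_
  rw [← normalize_normalized_factor P hP, ← normalize_normalized_factor Q hQ]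
  exact normalize_eq_normalize_iff_associated.mpr (hp.associated_of_dvd hq h)

theorem prod_dvd_of_subset_primeFactors {K : Type} [Field K] {R : K[X]} {s : Finset K[X]}
    (hs : s ⊆ primeFactors R) : ∏ P ∈ s, P ∣ R :=
  Finset.prod_dvd_of_coprime
    (fun _ hP _ hQ hne ↦ isCoprime_of_mem_primeFactors (hs hP) (hs hQ) hne)
    fun _ hP ↦ dvd_of_mem_normalizedFactors (mem_primeFactors.mp (hs hP))

theorem trivialMod_div_prod_iff {K : Type} [Field K] {R : K[X]} (hR : R ≠ 0) {s : Finset K[X]}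
    (hs : s ⊆ primeFactors R) (χ : MulChar (K[X] ⧸ Ideal.span {R}) ℂ) :
    TrivialMod R (R / ∏ P ∈ s, P) χ ↔ ∀ P ∈ s, TrivialMod R (R / P) χ := by
  induction s using Finset.induction_on with
  | empty => simpa using trivialMod_self R χ
  | insert P s hPs ih =>
    obtain ⟨W, hW⟩ := prod_dvd_of_subset_primeFactors hs
    rw [Finset.insert_subset_iff] at hs
    rw [Finset.forall_mem_insert, ← ih hs.2]
    rw [Finset.prod_insert hPs] at hW ⊢
    set Q := ∏ P ∈ s, P
    have hP0 : P ≠ 0 := by rintro rfl; exact hR (by simpa using hW)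
    have hQ0 : Q ≠ 0 := by intro h; exact hR (by simpa [h] using hW)
    have e1 : R / (P * Q) = W := by
      rw [hW, mul_div_cancel_left₀ _ (mul_ne_zero hP0 hQ0)]
    have e2 : R / P = Q * W := by rw [hW, mul_assoc, mul_div_cancel_left₀ _ hP0]
    have e3 : R / Q = P * W := by rw [hW, mul_comm P, mul_assoc, mul_div_cancel_left₀ _ hQ0]
    rw [e1, e2, e3]
    refine ⟨fun h ↦ ⟨trivialMod_mono (dvd_mul_left _ _) h, trivialMod_mono (dvd_mul_left _ _) h⟩,
      fun h ↦ .of_isCoprime hW (IsCoprime.prod_right fun Q hQ ↦ ?_) h.1 h.2⟩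
    exact isCoprime_of_mem_primeFactors hs.1 (hs.2 hQ) (by rintro rfl; exact hPs hQ)

theorem monic_of_mem_primeFactors {K : Type} [Field K] {R P : K[X]}
    (hP : P ∈ primeFactors R) : P.Monic := by
  rw [mem_primeFactors] at hP
  rw [← normalize_normalized_factor P hP]
  exact monic_normalize (prime_of_normalized_factor P hP).ne_zero

theorem isPrimitiveChar_iff {K : Type} [Field K] {R : K[X]} (hR : R.Monic)
    (χ : MulChar (K[X] ⧸ Ideal.span {R}) ℂ) :
    IsPrimitiveChar R χ ↔ ∀ P ∈ primeFactors R, ¬ TrivialMod R (R / P) χ := by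
  constructor
  · intro h P hP hT
    have hPm := monic_of_mem_primeFactors hP
    rw [mem_primeFactors] at hP
    have hmul := EuclideanDomain.mul_div_cancel' hPm.ne_zero (dvd_of_mem_normalizedFactors hP)
    have hdvd : R / P ∣ R := ⟨P, by rw [mul_comm, hmul]⟩
    have hSm : (R / P).Monic := hPm.of_mul_monic_left (by rwa [hmul])
    refine h (R / P) hSm hdvd ?_ ((exists_mulChar_eq_iff_trivialMod hR.ne_zero hdvd χ).mpr hT)
    have hpos := (irreducible_of_normalized_factor P hP).natDegree_pos
    have := congrArg natDegree hmul
    rw [hPm.natDegree_mul hSm] at this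
    omega
  · rintro h S - hS hdeg hχ
    rw [exists_mulChar_eq_iff_trivialMod hR.ne_zero hS] at hχ
    obtain ⟨E, rfl⟩ := hS
    have hE0 : E ≠ 0 := right_ne_zero_of_mul hR.ne_zero
    have hEu : ¬ IsUnit E := fun hE ↦ by
      rw [natDegree_mul (left_ne_zero_of_mul hR.ne_zero) hE0,
        natDegree_eq_zero_of_isUnit hE] at hdeg
      omega
    obtain ⟨P, hP⟩ := exists_mem_normalizedFactors hE0 hEu
    have hP' : P ∈ primeFactors (S * E) := by
      rw [mem_primeFactors]
      exact Multiset.mem_of_le ((dvd_iff_normalizedFactors_le_normalizedFactors hE0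
        hR.ne_zero).mp (dvd_mul_left _ _)) hP
    refine h P hP' (trivialMod_mono ?_ hχ)
    obtain ⟨F, rfl⟩ := dvd_of_mem_normalizedFactors hP
    rw [mul_left_comm, mul_div_cancel_left₀ _ (left_ne_zero_of_mul hE0)]
    exact dvd_mul_right _ _

theorem normalizedFactors_prod_of_subset {K : Type} [Field K] {R : K[X]} {s : Finset K[X]}
    (hs : s ⊆ primeFactors R) : normalizedFactors (∏ P ∈ s, P) = s.val := by
  have h (P) (hP : P ∈ s.val) := mem_primeFactors.mp (hs hP)
  rw [Finset.prod, Multiset.map_id', normalizedFactors_prod_eq _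
    fun P hP ↦ irreducible_of_normalized_factor P (h P hP)]
  exact (Multiset.map_congr rfl fun P hP ↦ normalize_normalized_factor P (h P hP)).trans
    (Multiset.map_id _)

theorem polyMu_prod_of_subset {K : Type} [Field K] {R : K[X]} {s : Finset K[X]}
    (hs : s ⊆ primeFactors R) : polyMu (∏ P ∈ s, P) = (-1) ^ s.card := by
  have h := normalizedFactors_prod_of_subset hs
  have h0 : ∏ P ∈ s, P ≠ 0 :=
    Finset.prod_ne_zero_iff.mpr fun P hP ↦ (monic_of_mem_primeFactors (hs hP)).ne_zero
  rw [polyMu, if_pos, h, Finset.val_toFinset]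
  rw [squarefree_iff_nodup_normalizedFactors h0, h]
  exact s.nodup

theorem prod_primeFactors_of_squarefree {K : Type} [Field K] {E : K[X]} (hE : E.Monic)
    (hsq : Squarefree E) : ∏ P ∈ primeFactors E, P = E := by
  rw [Finset.prod, Multiset.map_id', primeFactors_val_eq_normalizedFactors
    ((isRadical_iff_squarefree_of_ne_zero hE.ne_zero).mpr hsq),
    prod_normalizedFactors_eq hE.ne_zero, hE.normalize_eq_self]

theorem sum_powerset_primeFactors_eq_tsum {K : Type} [Field K] {R D : K[X]} (hR : R.Monic) :
    ∑ s ∈ (primeFactors R).powerset, (-1 : ℤ) ^ s.card •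
        (if R / ∏ P ∈ s, P ∣ D then (polyPhi (R / ∏ P ∈ s, P) : ℂ) else 0) =
      ∑' p : {p : K[X] × K[X] //
          p.1.Monic ∧ p.2.Monic ∧ p.1 * p.2 = R ∧ p.2 ∣ D},
        (polyMu p.1.1 : ℂ) * (polyPhi p.1.2 : ℂ) := by
  let V : Set (K[X] × K[X]) := {p | p.1.Monic ∧ p.2.Monic ∧ p.1 * p.2 = R ∧ p.2 ∣ D}
  let g : K[X] × K[X] → ℂ := fun p ↦ (polyMu p.1 : ℂ) * (polyPhi p.2 : ℂ)
  let e : Finset K[X] → K[X] × K[X] := fun s ↦ (∏ P ∈ s, P, R / ∏ P ∈ s, P)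
  change _ = ∑' p : V, g p
  have hinj : Set.InjOn e (primeFactors R).powerset := fun s hs t ht hst ↦ by
    rw [Finset.mem_coe, Finset.mem_powerset] at hs ht
    rw [← Finset.val_inj, ← normalizedFactors_prod_of_subset hs,
      ← normalizedFactors_prod_of_subset ht]
    exact congrArg normalizedFactors (congrArg Prod.fst hst)
  rw [tsum_subtype V g, tsum_eq_sum (s := (primeFactors R).powerset.image e),
    Finset.sum_image hinj]
  · refine Finset.sum_congr rfl fun s hs ↦ ?_
    rw [Finset.mem_powerset] at hs
    have hEm : (∏ P ∈ s, P).Monic :=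
      monic_prod_of_monic _ _ fun P hP ↦ monic_of_mem_primeFactors (hs hP)
    have hmul := EuclideanDomain.mul_div_cancel' hEm.ne_zero (prod_dvd_of_subset_primeFactors hs)
    have hV : e s ∈ V ↔ R / ∏ P ∈ s, P ∣ D :=
      ⟨fun h ↦ h.2.2.2, fun h ↦ ⟨hEm, hEm.of_mul_monic_left (by rwa [hmul]), hmul, h⟩⟩
    simp only [Set.indicator_apply, hV]
    simp only [g, e, polyMu_prod_of_subset hs]
    split_ifs <;> simp
  · rintro ⟨E, F⟩ hp
    refine Set.indicator_apply_eq_zero.mpr ?_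
    rintro ⟨hE, hF, hEF, -⟩
    simp only at hE hF hEF
    by_cases hsq : Squarefree E
    · refine absurd (Finset.mem_image.mpr ⟨primeFactors E, ?_, ?_⟩) hp
      · rw [Finset.mem_powerset]
        intro P hP
        rw [mem_primeFactors] at hP ⊢
        exact Multiset.mem_of_le ((dvd_iff_normalizedFactors_le_normalizedFactors hE.ne_zero
          hR.ne_zero).mp ⟨F, hEF.symm⟩) hP
      · simp only [e, prod_primeFactors_of_squarefree hE hsq]
        rw [← hEF, mul_div_cancel_left₀ _ hE.ne_zero]
    · simp [g, polyMu, hsq]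

/-- Orthogonality for primitive characters: for monic `R` and `A, B ∈ Fq[X]`,
`Σ*_χ χ(A) conj(χ)(B)` equals `Σ_{EF=R, F | A-B} μ(E) φ(F)` if `gcd(AB,R)=1`, and `0`
otherwise. -/
theorem primitive_char_orthogonality (R : Fq[X]) (hR : R.Monic) (A B : Fq[X]) :
    (IsCoprime (A * B) R →
      ∑' χ : {χ : MulChar (Fq[X] ⧸ Ideal.span {R}) ℂ // IsPrimitiveChar R χ},
          χ.1 (Ideal.Quotient.mk (Ideal.span {R}) A) *
            (starRingEnd ℂ) (χ.1 (Ideal.Quotient.mk (Ideal.span {R}) B))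
        = ∑' p : {p : Fq[X] × Fq[X] //
              p.1.Monic ∧ p.2.Monic ∧ p.1 * p.2 = R ∧ p.2 ∣ A - B},
            (polyMu p.1.1 : ℂ) * (polyPhi p.1.2 : ℂ)) ∧
    (¬ IsCoprime (A * B) R →
      ∑' χ : {χ : MulChar (Fq[X] ⧸ Ideal.span {R}) ℂ // IsPrimitiveChar R χ},
          χ.1 (Ideal.Quotient.mk (Ideal.span {R}) A) *
            (starRingEnd ℂ) (χ.1 (Ideal.Quotient.mk (Ideal.span {R}) B))
        = 0) := by
  have := finite_quotient_span_singleton hR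
  have : Fintype (MulChar (Fq[X] ⧸ Ideal.span {R}) ℂ) := Fintype.ofFinite _
  constructor
  · intro h
    have hA : IsCoprime A R := h.of_mul_left_left
    have hB : IsCoprime B R := h.of_mul_left_right
    let f : MulChar (Fq[X] ⧸ Ideal.span {R}) ℂ → ℂ := fun χ ↦
      χ (Ideal.Quotient.mk (Ideal.span {R}) A) *
        (starRingEnd ℂ) (χ (Ideal.Quotient.mk (Ideal.span {R}) B))
    let H : Fq[X] → Finset (MulChar (Fq[X] ⧸ Ideal.span {R}) ℂ) := fun P ↦
      Finset.univ.filter (TrivialMod R (R / P))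
    have hprim (χ) : χ ∈ (primeFactors R).inf (fun P ↦ (H P)ᶜ) ↔ IsPrimitiveChar R χ := by
      simp [Finset.mem_inf, H, isPrimitiveChar_iff hR]
    rw [← sum_powerset_primeFactors_eq_tsum hR, tsum_fintype]
    refine (Finset.sum_subtype _ hprim f).symm.trans ?_
    rw [Finset.inclusion_exclusion_sum_inf_compl]
    refine Finset.sum_congr rfl fun s hs ↦ ?_
    rw [Finset.mem_powerset] at hs
    have hdvd : R / ∏ P ∈ s, P ∣ R :=
      EuclideanDomain.div_dvd_of_dvd (prod_dvd_of_subset_primeFactors hs)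
    rw [← sum_trivialMod hR hdvd hA hB]
    congr 2
    ext χ
    simp [Finset.mem_inf, H, trivialMod_div_prod_iff hR.ne_zero hs]
  · intro h
    have hAB : ¬ IsCoprime A R ∨ ¬ IsCoprime B R := by
      by_contra! hc
      exact h (hc.1.mul_left hc.2)
    rw [← tsum_zero]
    congr 1 with χ
    rcases hAB with hA | hB
    · rw [MulChar.map_nonunit _ ((isUnit_quotient_mk_iff_isCoprime R A).not.mpr hA), zero_mul]
    · rw [MulChar.map_nonunit _ ((isUnit_quotient_mk_iff_isCoprime R B).not.mpr hB), map_zero,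
        mul_zero]
end
end

section
/- For every monic polynomial R in F_q[T] with deg(R) > q, φ(R) ≫ |R| / log_q log_q |R|, i.e., there is an absolute constant c > 0 with φ(R) ≥ c·|R|/log_q(deg R). -/
open Polynomial UniqueFactorizationMonoid
open scoped Classical

noncomputable section

variable {Fq : Type} [Field Fq] [Fintype Fq]

open Finset in
/-- There are at most `q ^ n / n` monic irreducible polynomials of degree `n`. -/
lemma natDegree_mul_card_irreducible_le {K : Type} [Field K] [Fintype K] {n : ℕ} (hn : n ≠ 0)
    (S : Finset K[X]) (hS : ∀ P ∈ S, P.Monic ∧ Irreducible P ∧ P.natDegree = n) :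
    n * #S ≤ Fintype.card K ^ n := by
  have hq : 1 < Fintype.card K := Fintype.one_lt_card
  have hdvd : ∏ P ∈ S, P ∣ X ^ Fintype.card K ^ n - X := by
    refine Finset.prod_dvd_of_coprime ?_ ?_
    · intro P hP Q hQ hPQ
      refine ((hS P hP).2.1.coprime_iff_not_dvd).2 fun h ↦ hPQ ?_
      exact eq_of_monic_of_associated (hS P hP).1 (hS Q hQ).1
        ((hS P hP).2.1.associated_of_dvd (hS Q hQ).2.1 h)
    · intro P hP
      have := (hS P hP).2.1.natDegree_dvd_iff_dvd_X_pow_card_pow_sub_X (n := n)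
      rw [Nat.card_eq_fintype_card] at this
      exact this.1 (hS P hP).2.2.dvd
  have h := natDegree_le_of_dvd hdvd (FiniteField.X_pow_card_pow_sub_X_ne_zero K hn hq)
  rw [FiniteField.X_pow_card_pow_sub_X_natDegree_eq K hn hq,
    natDegree_prod_of_monic _ _ fun P hP ↦ (hS P hP).1,
    Finset.sum_congr rfl fun P hP ↦ (hS P hP).2.2, Finset.sum_const, smul_eq_mul] at h
  rwa [mul_comm]

lemma exp_neg_le_one_sub {x : ℝ} (h : x ≤ 1 / 2) :
    Real.exp (-(x + 2 * x ^ 2)) ≤ 1 - x := by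
  rw [Real.exp_neg]
  refine inv_le_of_inv_le₀ (by linarith) ?_
  have h1 : (1 - x)⁻¹ ≤ 1 + (x + 2 * x ^ 2) := by
    rw [inv_le_iff_one_le_mul₀ (by linarith)]
    nlinarith [mul_nonneg (sq_nonneg x) (by linarith : 0 ≤ 1 - 2 * x)]
  linarith [Real.add_one_le_exp (x + 2 * x ^ 2)]

lemma inv_pnorm_le_half {K : Type} [Field K] [Fintype K] {P : K[X]} (hP : P.natDegree ≠ 0) :
    (pnorm P)⁻¹ ≤ 1 / 2 := by
  have hq : (2 : ℝ) ≤ Fintype.card K := by exact_mod_cast Fintype.one_lt_card (α := K)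
  rw [one_div]
  exact inv_anti₀ two_pos (hq.trans (le_self_pow₀ (by linarith) hP))

lemma pnorm_pos {K : Type} [Field K] [Fintype K] (P : K[X]) : 0 < pnorm P :=
  pow_pos (by exact_mod_cast Fintype.card_pos (α := K)) _

lemma sum_Icc_inv_le (m : ℕ) : ∑ n ∈ Finset.Icc 1 m, (n : ℝ)⁻¹ ≤ 1 + Real.log m := by
  have := harmonic_le_one_add_log m
  rw [harmonic_eq_sum_Icc] at this
  push_cast at this
  exact this

lemma sum_Icc_half_pow_le (m : ℕ) : ∑ n ∈ Finset.Icc 1 m, (1 / 2 : ℝ) ^ n ≤ 1 := by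
  have : ∑ n ∈ Finset.Icc 1 m, (1 / 2 : ℝ) ^ n = 1 - (1 / 2) ^ m := by
    induction m with
    | zero => simp
    | succ k ih => rw [Finset.sum_Icc_succ_top (by lia), ih]; ring
  rw [this]
  linarith [pow_nonneg (by norm_num : (0 : ℝ) ≤ 1 / 2) m]

/-- A Mertens-type upper bound over irreducibles of degree at most `m`. -/
lemma sum_inv_pnorm_le {K : Type} [Field K] [Fintype K] (m : ℕ) (S : Finset K[X])
    (hS : ∀ P ∈ S, P.Monic ∧ Irreducible P ∧ P.natDegree ≤ m) :
    ∑ P ∈ S, ((pnorm P)⁻¹ + 2 * (pnorm P)⁻¹ ^ 2) ≤ 3 + Real.log m := by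
  set q : ℝ := (Fintype.card K : ℝ) with hq
  have hq2 : (2 : ℝ) ≤ q := by rw [hq]; exact_mod_cast Fintype.one_lt_card (α := K)
  have hmaps : ∀ P ∈ S, P.natDegree ∈ Finset.Icc 1 m := fun P hP ↦
    Finset.mem_Icc.2 ⟨(hS P hP).2.1.natDegree_pos, (hS P hP).2.2⟩
  rw [← Finset.sum_fiberwise_of_maps_to hmaps]
  calc _ ≤ ∑ n ∈ Finset.Icc 1 m, ((n : ℝ)⁻¹ + 2 * (1 / 2) ^ n) := ?_
    _ ≤ 3 + Real.log m := by
      rw [Finset.sum_add_distrib, ← Finset.mul_sum]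
      linarith [sum_Icc_inv_le m, sum_Icc_half_pow_le m]
  refine Finset.sum_le_sum fun n hn ↦ ?_
  have hn1 : 1 ≤ n := (Finset.mem_Icc.1 hn).1
  have hn1' : (1 : ℝ) ≤ n := by exact_mod_cast hn1
  have hcard := natDegree_mul_card_irreducible_le (by lia : n ≠ 0)
    (S.filter fun P ↦ P.natDegree = n) fun P hP ↦ by
      rw [Finset.mem_filter] at hP
      exact ⟨(hS P hP.1).1, (hS P hP.1).2.1, hP.2⟩
  have hterm : ∀ P ∈ S.filter (fun P ↦ P.natDegree = n),
      (pnorm P)⁻¹ + 2 * (pnorm P)⁻¹ ^ 2 = (q ^ n)⁻¹ + 2 * (q ^ n)⁻¹ ^ 2 := fun P hP ↦ by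
    rw [pnorm, (Finset.mem_filter.1 hP).2]
  rw [Finset.sum_congr rfl hterm, Finset.sum_const, nsmul_eq_mul]
  set N := (S.filter fun P ↦ P.natDegree = n).card
  have hcard' : (n : ℝ) * N ≤ q ^ n := by rw [hq]; exact_mod_cast hcard
  have hqn : 0 < q ^ n := by positivity
  have hN : (N : ℝ) * (q ^ n)⁻¹ ≤ (n : ℝ)⁻¹ := by
    rw [← div_eq_mul_inv, div_le_iff₀ hqn, inv_mul_eq_div, le_div_iff₀ (by linarith)]
    linarith
  have hhalf : (q ^ n)⁻¹ ≤ (1 / 2) ^ n := by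
    rw [one_div, inv_pow]
    exact inv_anti₀ (by positivity) (pow_le_pow_left₀ (by norm_num) hq2 n)
  have hninv : (n : ℝ)⁻¹ ≤ 1 := inv_le_one_of_one_le₀ hn1'
  have hsq : (N : ℝ) * (q ^ n)⁻¹ * (q ^ n)⁻¹ ≤ 1 * (1 / 2) ^ n :=
    mul_le_mul (hN.trans hninv) hhalf (by positivity) (by norm_num)
  linarith

/-- Mertens-type lower bound for the product over irreducibles of degree at most `m`. -/
lemma exp_neg_three_div_le_prod {K : Type} [Field K] [Fintype K] {m : ℕ} (hm : m ≠ 0)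
    (S : Finset K[X]) (hS : ∀ P ∈ S, P.Monic ∧ Irreducible P ∧ P.natDegree ≤ m) :
    Real.exp (-3) / m ≤ ∏ P ∈ S, (1 - (pnorm P)⁻¹) := by
  have hm0 : (0 : ℝ) < m := by exact_mod_cast Nat.pos_of_ne_zero hm
  calc Real.exp (-3) / m = Real.exp (-(3 + Real.log m)) := by
        rw [neg_add, Real.exp_add, Real.exp_neg (Real.log m), Real.exp_log hm0, div_eq_mul_inv]
    _ ≤ Real.exp (∑ P ∈ S, -((pnorm P)⁻¹ + 2 * (pnorm P)⁻¹ ^ 2)) := by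
        rw [Real.exp_le_exp, Finset.sum_neg_distrib]
        exact neg_le_neg (sum_inv_pnorm_le m S hS)
    _ = ∏ P ∈ S, Real.exp (-((pnorm P)⁻¹ + 2 * (pnorm P)⁻¹ ^ 2)) := Real.exp_sum _ _
    _ ≤ _ := Finset.prod_le_prod (fun _ _ ↦ (Real.exp_pos _).le) fun P hP ↦
        exp_neg_le_one_sub (inv_pnorm_le_half (hS P hP).2.1.natDegree_pos.ne')

lemma half_le_prod_of_le_natDegree {K : Type} [Field K] [Fintype K] {m d : ℕ} (hm : 2 ≤ m)
    (hd : d ≤ Fintype.card K ^ m) (S : Finset K[X]) (hS : ∀ P ∈ S, m ≤ P.natDegree)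
    (hsum : ∑ P ∈ S, P.natDegree ≤ d) :
    1 / 2 ≤ ∏ P ∈ S, (1 - (pnorm P)⁻¹) := by
  set q : ℝ := (Fintype.card K : ℝ) with hq
  have hq2 : (2 : ℝ) ≤ q := by rw [hq]; exact_mod_cast Fintype.one_lt_card (α := K)
  have hqm : 0 < q ^ m := by positivity
  have hinv : (q ^ m)⁻¹ ≤ 1 := inv_le_one_of_one_le₀ (one_le_pow₀ (by linarith))
  have hcard : S.card * m ≤ d := by
    rw [← smul_eq_mul]
    exact (Finset.card_nsmul_le_sum S _ m hS).trans hsum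
  have hcard' : (S.card : ℝ) * 2 ≤ q ^ m := by
    rw [hq]
    exact_mod_cast ((Nat.mul_le_mul_left _ hm).trans hcard).trans hd
  calc (1 / 2 : ℝ) ≤ 1 + S.card * (-(q ^ m)⁻¹) := by
        have : (S.card : ℝ) * (q ^ m)⁻¹ ≤ 1 / 2 := by
          rw [← div_eq_mul_inv, div_le_iff₀ hqm]; linarith
        linarith
    _ ≤ (1 + -(q ^ m)⁻¹) ^ S.card := one_add_mul_le_pow (by linarith) _
    _ = ∏ _P ∈ S, (1 + -(q ^ m)⁻¹) := (Finset.prod_const _).symm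
    _ ≤ _ := Finset.prod_le_prod (fun _ _ ↦ by linarith) fun P hP ↦ by
        have : (pnorm P)⁻¹ ≤ (q ^ m)⁻¹ :=
          inv_anti₀ hqm (pow_le_pow_right₀ (by linarith) (hS P hP))
        linarith

lemma natCard_quotient_span_singleton {K : Type} [Field K] [Fintype K] {f : K[X]} (hf : f ≠ 0) :
    Nat.card (K[X] ⧸ Ideal.span {f}) = Fintype.card K ^ f.natDegree := by
  have : Module.Finite K (K[X] ⧸ Ideal.span {f}) :=
    Module.Finite.of_basis (AdjoinRoot.powerBasis hf).basis
  rw [Module.natCard_eq_pow_finrank (K := K), finrank_quotient_span_eq_natDegree,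
    Nat.card_eq_fintype_card]

lemma polyPhi_mul_of_isCoprime {K : Type} [Field K] {f g : K[X]} (h : IsCoprime f g) :
    polyPhi (f * g) = polyPhi f * polyPhi g := by
  have h' : IsCoprime (Ideal.span {f}) (Ideal.span {g}) :=
    (Ideal.isCoprime_span_singleton_iff f g).2 h
  rw [polyPhi, polyPhi, polyPhi, ← Ideal.span_singleton_mul_span_singleton, ← Nat.card_prod]
  exact Nat.card_congr ((Units.mapEquiv
    (Ideal.quotientMulEquivQuotientProd _ _ h').toMulEquiv).trans MulEquiv.prodUnits).toEquiv

lemma pnorm_mul {K : Type} [Field K] [Fintype K] {f g : K[X]} (hf : f ≠ 0) (hg : g ≠ 0) :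
    pnorm (f * g) = pnorm f * pnorm g := by
  rw [pnorm, natDegree_mul hf hg, pow_add, pnorm, pnorm]

lemma pnorm_mul_le_polyPhi_irreducible_pow {K : Type} [Field K] [Fintype K] {P : K[X]}
    (hP : Irreducible P) {k : ℕ} (hk : k ≠ 0) :
    pnorm (P ^ k) * (1 - (pnorm P)⁻¹) ≤ polyPhi (P ^ k) := by
  have hPk : P ^ k ≠ 0 := pow_ne_zero k hP.ne_zero
  have hcard := natCard_quotient_span_singleton hPk
  have hcardP := natCard_quotient_span_singleton hP.ne_zero
  set B := K[X] ⧸ Ideal.span {P ^ k}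
  have hfin : Finite B := Nat.finite_of_card_ne_zero <| by
    rw [hcard]; exact pow_ne_zero _ Fintype.card_ne_zero
  have hle : Ideal.span {P ^ k} ≤ Ideal.span {P} :=
    Ideal.span_singleton_le_span_singleton.2 (dvd_pow_self P hk)
  let f : B →+* K[X] ⧸ Ideal.span {P} := Ideal.Quotient.factor hle
  have hf : Function.Surjective f := Ideal.Quotient.factor_surjective hle
  have hker : Nat.card B = Nat.card (K[X] ⧸ Ideal.span {P}) * Nat.card f.toAddMonoidHom.ker := by
    rw [AddSubgroup.card_eq_card_quotient_mul_card_addSubgroup f.toAddMonoidHom.ker]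
    congr 1
    exact Nat.card_congr (QuotientAddGroup.quotientKerEquivOfSurjective f.toAddMonoidHom hf).toEquiv
  have hcover : (Set.univ : Set B) ⊆ Set.range (Units.val : Bˣ → B) ∪ f.toAddMonoidHom.ker := by
    intro x _
    obtain ⟨a, rfl⟩ := Ideal.Quotient.mk_surjective x
    by_cases ha : P ∣ a
    · right
      change f (Ideal.Quotient.mk _ a) = 0
      rw [Ideal.Quotient.factor_mk, Ideal.Quotient.eq_zero_iff_mem, Ideal.mem_span_singleton]
      exact ha
    · left
      obtain ⟨u, v, huv⟩ := ((hP.coprime_iff_not_dvd).2 ha).pow_left (m := k)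
      have h1 : Ideal.Quotient.mk (Ideal.span {P ^ k}) v * Ideal.Quotient.mk _ a = 1 := by
        rw [← map_mul, ← map_one (Ideal.Quotient.mk (Ideal.span {P ^ k})), Ideal.Quotient.eq,
          Ideal.mem_span_singleton]
        exact ⟨-u, by linear_combination huv⟩
      exact IsUnit.of_mul_eq_one_right _ h1
  have hcount : Nat.card B ≤ polyPhi (P ^ k) + Nat.card f.toAddMonoidHom.ker := by
    have h := (Set.ncard_le_ncard hcover).trans (Set.ncard_union_le _ _)
    rw [Set.ncard_univ, ← Nat.card_coe_set_eq, ← Nat.card_coe_set_eq,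
      Nat.card_range_of_injective Units.val_injective] at h
    exact h
  rw [hcard, hcardP] at hker
  rw [hcard] at hcount
  have hker' : pnorm (P ^ k) = pnorm P * Nat.card f.toAddMonoidHom.ker := by
    rw [pnorm, pnorm]; exact_mod_cast hker
  have hcount' : pnorm (P ^ k) ≤ polyPhi (P ^ k) + Nat.card f.toAddMonoidHom.ker := by
    rw [pnorm]; exact_mod_cast hcount
  have hne := (pnorm_pos P).ne'
  have : pnorm (P ^ k) * (pnorm P)⁻¹ = Nat.card f.toAddMonoidHom.ker := by
    rw [hker']; field_simp
  linarith

lemma pnorm_normalize {K : Type} [Field K] [Fintype K] (P : K[X]) :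
    pnorm (normalize P) = pnorm P := by
  rw [pnorm, pnorm, natDegree_eq_of_degree_eq degree_normalize]

/-- The lower-bound half of the product formula for the Euler totient. -/
lemma pnorm_mul_prod_le_polyPhi {K : Type} [Field K] [Fintype K] {R : K[X]} (hR : R ≠ 0) :
    pnorm R * ∏ P ∈ (normalizedFactors R).toFinset, (1 - (pnorm P)⁻¹) ≤ polyPhi R := by
  induction R using induction_on_coprime with
  | h0 => exact absurd rfl hR
  | @h1 u hu =>
    rw [normalizedFactors_of_isUnit hu, pnorm, natDegree_eq_zero_of_isUnit hu, polyPhi]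
    have : Ideal.span {u} = ⊤ := Ideal.span_singleton_eq_top.2 hu
    have hs : Subsingleton (K[X] ⧸ Ideal.span {u}) := Ideal.Quotient.subsingleton_iff.2 this
    simp
  | @hpr P k hP =>
    rcases eq_or_ne k 0 with rfl | hk
    · rw [pow_zero, normalizedFactors_one, polyPhi, pnorm, Ideal.span_singleton_one]
      have hs : Subsingleton (K[X] ⧸ (⊤ : Ideal K[X])) := Ideal.Quotient.subsingleton_iff.2 rfl
      simp
    · rw [normalizedFactors_pow, normalizedFactors_irreducible hP.irreducible,
        Multiset.toFinset_nsmul _ _ hk, Multiset.toFinset_singleton, Finset.prod_singleton,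
        pnorm_normalize]
      exact pnorm_mul_le_polyPhi_irreducible_pow hP.irreducible hk
  | @hcp f g hfg hf hg =>
    have hf0 : f ≠ 0 := left_ne_zero_of_mul hR
    have hg0 : g ≠ 0 := right_ne_zero_of_mul hR
    rw [polyPhi_mul_of_isCoprime hfg.isCoprime, pnorm_mul hf0 hg0,
      normalizedFactors_mul hf0 hg0, Multiset.toFinset_add, Finset.prod_union, Nat.cast_mul,
      mul_mul_mul_comm]
    · refine mul_le_mul (hf hf0) (hg hg0) (mul_nonneg (pnorm_pos g).le
        (Finset.prod_nonneg fun P hP ↦ ?_)) (Nat.cast_nonneg _)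
      rw [Multiset.mem_toFinset] at hP
      linarith [inv_pnorm_le_half (irreducible_of_normalized_factor P hP).natDegree_pos.ne']
    · rw [Multiset.disjoint_toFinset]
      exact disjoint_normalizedFactors hfg

lemma sum_natDegree_normalizedFactors_le {K : Type} [Field K] {R : K[X]} (hR : R ≠ 0) :
    ∑ P ∈ (normalizedFactors R).toFinset, P.natDegree ≤ R.natDegree := by
  rw [← natDegree_prod]
  · refine natDegree_le_of_dvd (dvd_trans ?_ (prod_normalizedFactors hR).dvd) hR
    rw [Finset.prod_eq_multiset_prod, Multiset.map_id', Multiset.toFinset_val]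
    exact Multiset.prod_dvd_prod_of_le (Multiset.dedup_le _)
  · intro P hP
    exact (irreducible_of_normalized_factor P (Multiset.mem_toFinset.1 hP)).ne_zero

/-- For monic `R` with `deg R > q`, `φ(R) ≫ |R| / log_q log_q |R|` with an absolute
constant, where `log_q log_q |R| = log_q (deg R)`. -/
theorem phi_lower_bound : ∃ c : ℝ, 0 < c ∧
    ∀ (K : Type) [Field K] [Fintype K] (R : K[X]), R.Monic →
      Fintype.card K < R.natDegree →
        c * pnorm R / (Real.log R.natDegree / Real.log (Fintype.card K))
          ≤ (polyPhi R : ℝ) := by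
  refine ⟨Real.exp (-3) / 2, by positivity, fun K _ _ R hR hdeg ↦ ?_⟩
  have hq : 1 < Fintype.card K := Fintype.one_lt_card
  set d := R.natDegree with hd
  set m := Nat.log (Fintype.card K) d with hm
  have hm0 : m ≠ 0 := (Nat.log_pos hq hdeg.le).ne'
  have hmpos : (0 : ℝ) < m := by exact_mod_cast Nat.pos_of_ne_zero hm0
  set S := (normalizedFactors R).toFinset with hS
  have hirr : ∀ P ∈ S, P.Monic ∧ Irreducible P := fun P hP ↦ by
    have hP' := Multiset.mem_toFinset.1 hP
    have hi := irreducible_of_normalized_factor P hP'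
    refine ⟨?_, hi⟩
    rw [← normalize_normalized_factor P hP']
    exact monic_normalize hi.ne_zero
  have hsmall : Real.exp (-3) / m ≤ ∏ P ∈ S with P.natDegree ≤ m, (1 - (pnorm P)⁻¹) :=
    exp_neg_three_div_le_prod hm0 _ fun P hP ↦ by
      rw [Finset.mem_filter] at hP
      exact ⟨(hirr P hP.1).1, (hirr P hP.1).2, hP.2⟩
  have hlarge : 1 / 2 ≤ ∏ P ∈ S with ¬ P.natDegree ≤ m, (1 - (pnorm P)⁻¹) := by
    refine half_le_prod_of_le_natDegree (m := m + 1) (d := d) (by lia)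
      (Nat.lt_pow_succ_log_self hq d).le _ (fun P hP ↦ ?_) ?_
    · have := (Finset.mem_filter.1 hP).2
      lia
    · exact (Finset.sum_le_sum_of_subset (Finset.filter_subset _ _)).trans
        (sum_natDegree_normalizedFactors_le hR.ne_zero)
  have hlog : (m : ℝ) ≤ Real.log d / Real.log (Fintype.card K) := by
    rw [Real.log_div_log]
    exact Real.natLog_le_logb d (Fintype.card K)
  have hmul : Real.exp (-3) / m * (1 / 2) ≤ ∏ P ∈ S, (1 - (pnorm P)⁻¹) := by
    rw [← Finset.prod_filter_mul_prod_filter_not S fun P ↦ P.natDegree ≤ m]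
    exact mul_le_mul hsmall hlarge (by norm_num) ((by positivity : _ ≤ _).trans hsmall)
  calc _ ≤ Real.exp (-3) / 2 * pnorm R / m :=
        div_le_div_of_nonneg_left (mul_nonneg (by positivity) (pnorm_pos R).le) hmpos hlog
    _ = pnorm R * (Real.exp (-3) / m * (1 / 2)) := by ring
    _ ≤ pnorm R * ∏ P ∈ S, (1 - (pnorm P)⁻¹) :=
        mul_le_mul_of_nonneg_left hmul (pnorm_pos R).le
    _ ≤ polyPhi R := pnorm_mul_prod_le_polyPhi hR.ne_zero
end
end
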